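/- (Theorem 3.2, Representation Theorem) Let A be a three-valued Łukasiewicz algebra, Ob the set of prime filters of A, R the comparability relation on Ob (P R Q iff P ⊆ Q or Q ⊆ P), M X = {P ∈ Ob | ∃ Q ∈ X, P R Q} and L X = {P ∈ Ob | ∀ Q, P R Q → Q ∈ X} for X ⊆ Ob, s(x) = {P ∈ Ob | x ∈ P} the Stone map, and h : A → Set Ob × Set Ob defined by h(x) = (L s(x), M s(x)). Then h is injective and preserves the operations: h(x ⊓ y) = (L s(x) ∩ L s(y), M s(x) ∩ M s(y)), h(x ⊔ y) = (L s(x) ∪ L s(y), M s(x) ∪ M s(y)), h(∼x) = ((M s(x))ᶜ, (L s(x))ᶜ), h(∇x) = (M s(x), M s(x)), h(⊥) = (∅, ∅), and h(⊤) = (Ob, Ob). Hence every three-valued Łukasiewicz algebra can be represented as an algebra of rough subsets of the approximation space (Ob, R). -/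

import Mathlib

/-- A prime filter of a bounded distributive lattice. -/
def IsPrimeFilter {A : Type*} [DistribLattice A] [BoundedOrder A] (P : Set A) : Prop :=
  P.Nonempty ∧ P ≠ Set.univ ∧ (∀ x ∈ P, ∀ y : A, x ≤ y → y ∈ P) ∧
    (∀ x ∈ P, ∀ y ∈ P, x ⊓ y ∈ P) ∧ (∀ x y : A, x ⊔ y ∈ P → x ∈ P ∨ y ∈ P)

namespace IsPrimeFilter

variable {A : Type*} [DistribLattice A] [BoundedOrder A] {P Q : Set A}

theorem mem_of_le (hP : IsPrimeFilter P) {x y : A} (hx : x ∈ P) (hxy : x ≤ y) : y ∈ P :=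
  hP.2.2.1 x hx y hxy

theorem top_mem (hP : IsPrimeFilter P) : ⊤ ∈ P :=
  hP.1.elim fun _ hx => hP.mem_of_le hx le_top

theorem bot_notMem (hP : IsPrimeFilter P) : ⊥ ∉ P := fun h =>
  hP.2.1 (Set.eq_univ_of_forall fun _ => hP.mem_of_le h bot_le)

theorem inf_mem_iff (hP : IsPrimeFilter P) {x y : A} : x ⊓ y ∈ P ↔ x ∈ P ∧ y ∈ P :=
  ⟨fun h => ⟨hP.mem_of_le h inf_le_left, hP.mem_of_le h inf_le_right⟩,
    fun h => hP.2.2.2.1 x h.1 y h.2⟩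

theorem sup_mem_iff (hP : IsPrimeFilter P) {x y : A} : x ⊔ y ∈ P ↔ x ∈ P ∨ y ∈ P :=
  ⟨hP.2.2.2.2 x y,
    fun h => h.elim (fun h => hP.mem_of_le h le_sup_left) fun h => hP.mem_of_le h le_sup_right⟩

/-- The complement of a prime ideal is a prime filter. -/
theorem compl_of_isPrime {J : Order.Ideal A} (hJ : J.IsPrime) :
    IsPrimeFilter ((J : Set A)ᶜ) := by
  have htop : ⊤ ∉ J := fun h => hJ.toIsProper.ne_univ
    (Set.eq_univ_of_forall fun _ => J.lower le_top h)
  refine ⟨⟨⊤, htop⟩, fun h => ?_, fun x hx y hxy hy => hx (J.lower hxy hy),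
    fun x hx y hy hxy => (hJ.mem_or_mem hxy).elim hx hy, fun x y hxy => ?_⟩
  · have hbot : (⊥ : A) ∈ (J : Set A)ᶜ := h ▸ Set.mem_univ _
    exact hbot J.bot_mem
  · by_contra! hc
    simp only [Set.mem_compl_iff, SetLike.mem_coe, not_not] at hc
    exact hxy (Order.Ideal.sup_mem hc.1 hc.2)

theorem exists_mem_notMem {x y : A} (hxy : ¬ x ≤ y) :
    ∃ P : Set A, IsPrimeFilter P ∧ x ∈ P ∧ y ∉ P := by
  have hd : Disjoint (Order.PFilter.principal x : Set A) (Order.Ideal.principal y : Set A) := by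
    rw [Set.disjoint_left]
    intro z hz hz'
    exact hxy (le_trans (Order.PFilter.mem_principal.1 hz) (Order.Ideal.mem_principal.1 hz'))
  obtain ⟨J, hJ, hyJ, hxJ⟩ := DistribLattice.prime_ideal_of_disjoint_filter_ideal hd
  exact ⟨_, compl_of_isPrime hJ,
    Set.disjoint_left.1 hxJ (Order.PFilter.mem_principal.2 le_rfl),
    fun h => h (hyJ (Order.Ideal.mem_principal.2 le_rfl))⟩

theorem ext_of_mem_iff {x y : A} (h : ∀ P : Set A, IsPrimeFilter P → (x ∈ P ↔ y ∈ P)) :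
    x = y := by
  by_contra hne
  by_cases hxy : x ≤ y
  · obtain ⟨P, hP, hy, hx⟩ := exists_mem_notMem fun hyx => hne (le_antisymm hxy hyx)
    exact hx ((h P hP).2 hy)
  · obtain ⟨P, hP, hx, hy⟩ := exists_mem_notMem hxy
    exact hy ((h P hP).1 hx)

/-- The Białynicki-Birula–Rasiowa transform of a prime filter. -/
theorem setOf_neg_notMem (hP : IsPrimeFilter P) {neg : A → A} (hinv : ∀ x, neg (neg x) = x)
    (hdm : ∀ x y, neg (x ⊔ y) = neg x ⊓ neg y) : IsPrimeFilter {x | neg x ∉ P} := by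
  have hdm' (x y : A) : neg (x ⊓ y) = neg x ⊔ neg y := by
    rw [← hinv (neg x ⊔ neg y), hdm, hinv, hinv]
  have htop : neg ⊤ = ⊥ := by
    have h := hdm ⊤ (neg ⊥)
    rw [top_sup_eq, hinv, inf_bot_eq] at h
    exact h
  have hbot : neg ⊥ = ⊤ := by rw [← htop, hinv]
  refine ⟨⟨⊤, ?_⟩, fun h => ?_, fun x hx y hxy hy => hx ?_, fun x hx y hy => ?_,
    fun x y hxy => ?_⟩
  · simpa only [Set.mem_ofPred_eq, htop] using hP.bot_notMem
  · have hb : (⊥ : A) ∈ {x | neg x ∉ P} := h ▸ Set.mem_univ _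
    exact hb (hbot ▸ hP.top_mem)
  · rw [← sup_eq_right.2 hxy, hdm, hP.inf_mem_iff] at hy
    exact hy.1
  · simp only [Set.mem_ofPred_eq] at hx hy ⊢
    rw [hdm', hP.sup_mem_iff]
    tauto
  · simp only [Set.mem_ofPred_eq] at hxy ⊢
    rw [hdm, hP.inf_mem_iff] at hxy
    tauto

theorem nabla_mem_iff (hP : IsPrimeFilter P) {neg nabla : A → A}
    (hax1 : ∀ x, neg x ⊔ nabla x = ⊤) (hax2 : ∀ x, x ⊓ neg x = neg x ⊓ nabla x) {x : A} :
    nabla x ∈ P ↔ x ∈ P ∨ neg x ∉ P := by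
  have h1 : neg x ∈ P ∨ nabla x ∈ P := hP.sup_mem_iff.1 (hax1 x ▸ hP.top_mem)
  have h2 : x ∈ P ∧ neg x ∈ P ↔ neg x ∈ P ∧ nabla x ∈ P := by
    rw [← hP.inf_mem_iff, ← hP.inf_mem_iff, hax2]
  tauto

/-- A prime filter is comparable with its Białynicki-Birula–Rasiowa transform. -/
theorem subset_or_subset_setOf_neg_notMem (hP : IsPrimeFilter P) {neg nabla : A → A}
    (hinv : ∀ x, neg (neg x) = x) (hdm : ∀ x y, neg (x ⊔ y) = neg x ⊓ neg y)
    (hax1 : ∀ x, neg x ⊔ nabla x = ⊤) (hax2 : ∀ x, x ⊓ neg x = neg x ⊓ nabla x)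
    (hax3 : ∀ x y, nabla (x ⊓ y) = nabla x ⊓ nabla y) :
    P ⊆ {x | neg x ∉ P} ∨ {x | neg x ∉ P} ⊆ P := by
  by_contra! hc
  obtain ⟨⟨a, ha, ha'⟩, ⟨b, hb, hb'⟩⟩ := And.imp Set.not_subset.1 Set.not_subset.1 hc
  have h : nabla (a ⊓ b) ∈ P := by
    rw [hax3, hP.inf_mem_iff, hP.nabla_mem_iff hax1 hax2, hP.nabla_mem_iff hax1 hax2]
    exact ⟨Or.inl ha, Or.inr hb⟩
  rcases (hP.nabla_mem_iff hax1 hax2).1 h with h | h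
  · exact hb' (hP.inf_mem_iff.1 h).2
  · exact ha' ((hP.setOf_neg_notMem hinv hdm).inf_mem_iff.1 h).1

theorem mem_or_neg_notMem_of_comparable (hP : IsPrimeFilter P) (hQ : IsPrimeFilter Q)
    {neg nabla : A → A} (hinv : ∀ x, neg (neg x) = x)
    (hdm : ∀ x y, neg (x ⊔ y) = neg x ⊓ neg y)
    (hax1 : ∀ x, neg x ⊔ nabla x = ⊤) (hax2 : ∀ x, x ⊓ neg x = neg x ⊓ nabla x)
    (hPQ : P ⊆ Q ∨ Q ⊆ P) {x : A} (hx : x ∈ Q) : x ∈ P ∨ neg x ∉ P := by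
  rcases hPQ with hPQ | hPQ
  · by_contra! hc
    have hP' := (hP.setOf_neg_notMem hinv hdm).nabla_mem_iff hax1 hax2 (x := x)
    have hQ' := (hQ.setOf_neg_notMem hinv hdm).nabla_mem_iff hax1 hax2 (x := x)
    simp only [Set.mem_ofPred_eq, hinv] at hP' hQ'
    have := @hPQ (neg (nabla x))
    tauto
  · exact Or.inl (hPQ hx)

theorem mem_of_comparable (hP : IsPrimeFilter P) (hQ : IsPrimeFilter Q)
    {neg nabla : A → A} (hinv : ∀ x, neg (neg x) = x)
    (hdm : ∀ x y, neg (x ⊔ y) = neg x ⊓ neg y)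
    (hax1 : ∀ x, neg x ⊔ nabla x = ⊤) (hax2 : ∀ x, x ⊓ neg x = neg x ⊓ nabla x)
    (hPQ : P ⊆ Q ∨ Q ⊆ P) {x : A} (hx : x ∈ P) (hx' : neg x ∉ P) : x ∈ Q := by
  by_contra hc
  have hcomp : {x | neg x ∉ P} ⊆ {x | neg x ∉ Q} ∨ {x | neg x ∉ Q} ⊆ {x | neg x ∉ P} :=
    hPQ.symm.imp (fun h _ hy hy' => hy (h hy')) (fun h _ hy hy' => hy (h hy'))
  have h := (hP.setOf_neg_notMem hinv hdm).mem_or_neg_notMem_of_comparable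
    (hQ.setOf_neg_notMem hinv hdm) hinv hdm hax1 hax2 hcomp (x := neg x)
  simp only [Set.mem_ofPred_eq, hinv] at h
  tauto

end IsPrimeFilter

/-- Theorem 3.2 (Representation Theorem): `h(x) = (L s(x), M s(x))` is an injective
map preserving the three-valued Łukasiewicz algebra operations; hence every
three-valued Łukasiewicz algebra can be represented as an algebra of rough subsets
of the approximation space of its prime filters with the comparability relation. -/
theorem lukasiewicz_representation {A : Type*} [DistribLattice A] [BoundedOrder A]
    (neg nabla : A → A)
    (hinv : ∀ x : A, neg (neg x) = x)
    (hdm : ∀ x y : A, neg (x ⊔ y) = neg x ⊓ neg y)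
    (hax1 : ∀ x : A, neg x ⊔ nabla x = ⊤)
    (hax2 : ∀ x : A, x ⊓ neg x = neg x ⊓ nabla x)
    (hax3 : ∀ x y : A, nabla (x ⊓ y) = nabla x ⊓ nabla y)
    (R : {P : Set A // IsPrimeFilter P} → {P : Set A // IsPrimeFilter P} → Prop)
    (hR : ∀ P Q, R P Q ↔ (P.1 ⊆ Q.1 ∨ Q.1 ⊆ P.1))
    (M L : Set {P : Set A // IsPrimeFilter P} → Set {P : Set A // IsPrimeFilter P})
    (hM : ∀ X, M X = {P | ∃ Q ∈ X, R P Q})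
    (hL : ∀ X, L X = {P | ∀ Q, R P Q → Q ∈ X})
    (s : A → Set {P : Set A // IsPrimeFilter P})
    (hs : ∀ x : A, s x = {P | x ∈ P.1})
    (h : A → Set {P : Set A // IsPrimeFilter P} × Set {P : Set A // IsPrimeFilter P})
    (hh : ∀ x : A, h x = (L (s x), M (s x))) :
    Function.Injective h ∧
    (∀ x y : A, h (x ⊓ y) = (L (s x) ∩ L (s y), M (s x) ∩ M (s y))) ∧
    (∀ x y : A, h (x ⊔ y) = (L (s x) ∪ L (s y), M (s x) ∪ M (s y))) ∧
    (∀ x : A, h (neg x) = ((M (s x))ᶜ, (L (s x))ᶜ)) ∧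
    (∀ x : A, h (nabla x) = (M (s x), M (s x))) ∧
    h ⊥ = (∅, ∅) ∧ h ⊤ = (Set.univ, Set.univ) := by
  have hU (x : A) (P : {P : Set A // IsPrimeFilter P}) :
      P ∈ M (s x) ↔ x ∈ P.1 ∨ neg x ∉ P.1 := by
    rw [hM, hs]
    constructor
    · rintro ⟨Q, hQ, hPQ⟩
      exact P.2.mem_or_neg_notMem_of_comparable Q.2 hinv hdm hax1 hax2 ((hR P Q).1 hPQ) hQ
    · rintro (hx | hx)
      · exact ⟨P, hx, (hR P P).2 (Or.inl subset_rfl)⟩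
      · exact ⟨⟨_, P.2.setOf_neg_notMem hinv hdm⟩, hx,
          (hR _ _).2 (P.2.subset_or_subset_setOf_neg_notMem hinv hdm hax1 hax2 hax3)⟩
  have hI (x : A) (P : {P : Set A // IsPrimeFilter P}) :
      P ∈ L (s x) ↔ x ∈ P.1 ∧ neg x ∉ P.1 := by
    rw [hL, hs]
    constructor
    · intro hx
      exact ⟨hx P ((hR P P).2 (Or.inl subset_rfl)),
        hx ⟨_, P.2.setOf_neg_notMem hinv hdm⟩
          ((hR _ _).2 (P.2.subset_or_subset_setOf_neg_notMem hinv hdm hax1 hax2 hax3))⟩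
    · rintro ⟨hx, hx'⟩ Q hPQ
      exact P.2.mem_of_comparable Q.2 hinv hdm hax1 hax2 ((hR P Q).1 hPQ) hx hx'
  have hcmp (P : {P : Set A // IsPrimeFilter P}) (x y : A) :
      ((x ∈ P.1 → neg x ∉ P.1) ∧ (y ∈ P.1 → neg y ∉ P.1)) ∨
        ((neg x ∉ P.1 → x ∈ P.1) ∧ (neg y ∉ P.1 → y ∈ P.1)) :=
    (P.2.subset_or_subset_setOf_neg_notMem hinv hdm hax1 hax2 hax3).imp
      (fun hc => ⟨@hc x, @hc y⟩) (fun hc => ⟨@hc x, @hc y⟩)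
  have hmeet (P : {P : Set A // IsPrimeFilter P}) (x y : A) :
      neg (x ⊓ y) ∉ P.1 ↔ neg x ∉ P.1 ∧ neg y ∉ P.1 :=
    (P.2.setOf_neg_notMem hinv hdm).inf_mem_iff
  have hjoin (P : {P : Set A // IsPrimeFilter P}) (x y : A) :
      neg (x ⊔ y) ∉ P.1 ↔ neg x ∉ P.1 ∨ neg y ∉ P.1 :=
    (P.2.setOf_neg_notMem hinv hdm).sup_mem_iff
  refine ⟨fun x y hxy => ?_, fun x y => ?_, fun x y => ?_, fun x => ?_, fun x => ?_, ?_, ?_⟩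
  · rw [hh, hh, Prod.mk.injEq] at hxy
    refine IsPrimeFilter.ext_of_mem_iff fun P hP => ?_
    have hl := Set.ext_iff.1 hxy.1 ⟨P, hP⟩
    have hm := Set.ext_iff.1 hxy.2 ⟨P, hP⟩
    simp only [hU, hI] at hl hm
    have hc := hcmp ⟨P, hP⟩ x y
    tauto
  · rw [hh]
    refine Prod.ext (Set.ext fun P => ?_) (Set.ext fun P => ?_)
    · simp only [Set.mem_inter_iff, hI, hmeet, P.2.inf_mem_iff]
      tauto
    · simp only [Set.mem_inter_iff, hU, hmeet, P.2.inf_mem_iff]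
      have hc := hcmp P x y
      tauto
  · rw [hh]
    refine Prod.ext (Set.ext fun P => ?_) (Set.ext fun P => ?_)
    · simp only [Set.mem_union, hI, hjoin, P.2.sup_mem_iff]
      have hc := hcmp P x y
      tauto
    · simp only [Set.mem_union, hU, hjoin, P.2.sup_mem_iff]
      tauto
  · rw [hh]
    refine Prod.ext (Set.ext fun P => ?_) (Set.ext fun P => ?_)
    · simp only [Set.mem_compl_iff, hI, hU, hinv]
      tauto
    · simp only [Set.mem_compl_iff, hI, hU, hinv]
      tauto
  · rw [hh]
    have hn (P : {P : Set A // IsPrimeFilter P}) := P.2.nabla_mem_iff hax1 hax2 (x := x)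
    have hn' (P : {P : Set A // IsPrimeFilter P}) :=
      (P.2.setOf_neg_notMem hinv hdm).nabla_mem_iff hax1 hax2 (x := x)
    simp only [Set.mem_ofPred_eq, hinv] at hn'
    refine Prod.ext (Set.ext fun P => ?_) (Set.ext fun P => ?_)
    · simp only [hI, hU, hn, hn']
      tauto
    · simp only [hU, hn, hn']
      tauto
  · rw [hh]
    refine Prod.ext (Set.ext fun P => ?_) (Set.ext fun P => ?_)
    · simp [hI, P.2.bot_notMem]
    · have := (P.2.setOf_neg_notMem hinv hdm).bot_notMem
      rw [Set.mem_ofPred_eq] at this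
      simp only [hU, P.2.bot_notMem, this, or_self, Set.mem_empty_iff_false]
  · rw [hh]
    refine Prod.ext (Set.ext fun P => ?_) (Set.ext fun P => ?_)
    · have := (P.2.setOf_neg_notMem hinv hdm).top_mem
      rw [Set.mem_ofPred_eq] at this
      simp only [hI, P.2.top_mem, this, not_false_eq_true, and_self, Set.mem_univ]
    · simp [hU, P.2.top_mem]
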